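/- Let m be odd and let d be an odd integer with 2 ≤ d ≤ 2^m - 2 and gcd(d, 2^m - 1) = 1. Assume the power function x ↦ x^d on F = GF(2^m) is maximum nonlinear, and assume that for all α, β ∈ F \ {0} with α ≠ β and all i, j ∈ GF(2) the cardinality |H^{i,j}(α,β) ∩ D_d| belongs to {2^(m-3), 2^(m-3) - 2^((m-3)/2), 2^(m-3) + 2^((m-3)/2)}. Then there exists a positive integer k with gcd(k, m) = 1 such that d = 2^k + 1. -/

import Mathlib

attribute [local instance] Classical.propDecidable

noncomputable instance (m : ℕ) : Fintype (GaloisField 2 m) := Fintype.ofFinite _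

/-- The absolute trace map from `GF(2^m)` to `GF(2)`. -/
noncomputable def tr (m : ℕ) (x : GaloisField 2 m) : ZMod 2 :=
  Algebra.trace (ZMod 2) (GaloisField 2 m) x

/-- `(-1)^t` as an integer, for `t ∈ GF(2)`. -/
def chi (t : ZMod 2) : ℤ := (-1) ^ t.val

/-- The Walsh coefficient `∑_{x ∈ F} (-1)^(tr(γx + βx^d))` of the power map `x ↦ x^d`. -/
noncomputable def walsh (m d : ℕ) (β γ : GaloisField 2 m) : ℤ :=
  ∑ x : GaloisField 2 m, chi (tr m (γ * x + β * x ^ d))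

/-- The power function `x ↦ x^d` on `GF(2^m)` is maximum nonlinear (almost bent). -/
def MaxNonlinear (m d : ℕ) : Prop :=
  ∀ β : GaloisField 2 m, β ≠ 0 → ∀ γ : GaloisField 2 m,
    walsh m d β γ ∈ ({0, 2 ^ ((m + 1) / 2), -(2 ^ ((m + 1) / 2))} : Set ℤ)

/-- `D_d = {x ∈ F : tr(x^d) = 1}`. -/
noncomputable def Dd (m d : ℕ) : Finset (GaloisField 2 m) :=
  Finset.univ.filter (fun x => tr m (x ^ d) = 1)

/-- `H^i(α) = {x ∈ F : tr(αx) = i}`. -/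
noncomputable def Hi (m : ℕ) (α : GaloisField 2 m) (i : ZMod 2) :
    Finset (GaloisField 2 m) :=
  Finset.univ.filter (fun x => tr m (α * x) = i)

/-- `H^{i,j}(α,β) = {x ∈ F : tr(αx) = i and tr(βx) = j}`. -/
noncomputable def Hij (m : ℕ) (α β : GaloisField 2 m) (i j : ZMod 2) :
    Finset (GaloisField 2 m) :=
  Finset.univ.filter (fun x => tr m (α * x) = i ∧ tr m (β * x) = j)

open Finset in
/-- A finite subset `I` of an abelian group with trivial stabilizer has at most two elements as soon
as the nonvanishing weights `v` sum to zero over the translations into `I` of every nonempty proper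
subset of `I`. -/
theorem card_le_two_of_sum_translates_eq_zero {G K : Type*} [AddCommGroup G]
    [AddCommMonoid K] (I : Finset G) (v : G → K) (hv : ∀ t, v t ≠ 0)
    (hI : ∀ t, (∀ x ∈ I, x + t ∈ I) → t = 0)
    (h : ∀ E ⊆ I, E.Nonempty → E ≠ I →
      ∀ S : Finset G, (∀ t, t ∈ S ↔ ∀ x ∈ E, x + t ∈ I) → ∑ t ∈ S, v t = 0) :
    I.card ≤ 2 := by
  by_contra! hw
  have key : ∀ i ∈ I, ∃ t, t ≠ 0 ∧ ∀ x ∈ I, x ≠ i → x + t ∈ I := by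
    intro i hi
    by_contra! hcon
    have hne : (I.erase i).Nonempty := by
      rw [← card_pos, card_erase_of_mem hi]; omega
    have h1 := h (I.erase i) (erase_subset _ _) hne (by
      intro heq; rw [← heq] at hi; exact notMem_erase _ _ hi)
    have : ∀ t, t ∈ ({0} : Finset G) ↔ ∀ x ∈ I.erase i, x + t ∈ I := by
      intro t
      simp only [mem_singleton, mem_erase]
      rw [iff_comm]
      constructor
      · intro ht
        by_contra h0
        obtain ⟨x, hx, hxi, hxt⟩ := hcon t h0
        exact hxt (ht x ⟨hxi, hx⟩)
      · rintro rfl x hx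
        simpa using hx.2
    specialize h1 _ this
    rw [sum_singleton] at h1
    exact hv 0 h1
  choose! t ht0 ht using key
  have hti : ∀ i ∈ I, i + t i ∉ I := by
    intro i hi hmem
    refine ht0 i hi (hI _ fun x hx => ?_)
    by_cases hxi : x = i
    · rwa [hxi]
    · exact ht i hi x hx hxi
  have htinj : ∀ i ∈ I, ∀ k ∈ I, t i = t k → i = k := by
    intro i hi k hk hik
    by_contra hne
    exact hti i hi (hik ▸ ht k hk i hi hne)
  have hsurj : Set.SurjOn (fun p : G × G => (p.2, p.2 + t p.1)) I.offDiag I.offDiag := by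
    refine surjOn_of_injOn_of_card_le _ ?_ ?_ le_rfl
    · rintro ⟨i, x⟩ hp
      simp only [coe_offDiag, Set.mem_offDiag, mem_coe] at hp ⊢
      exact ⟨hp.2.1, ht i hp.1 x hp.2.1 (Ne.symm hp.2.2), fun h0 => ht0 i hp.1 (by simpa using h0)⟩
    · rintro ⟨i, x⟩ hp ⟨k, y⟩ hq heq
      simp only [coe_offDiag, Set.mem_offDiag, mem_coe, Prod.mk.injEq] at hp hq heq ⊢
      obtain ⟨rfl, h2⟩ := heq
      exact ⟨htinj i hp.1 k hq.1 (by simpa using h2), rfl⟩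
  have hall : ∀ s, s ≠ 0 → ∀ x ∈ I, x + s ∈ I → ∃ l ∈ I, t l = s := by
    intro s hs x hx hxs
    obtain ⟨⟨l, y⟩, hly, heq⟩ := hsurj (a := (x, x + s)) (by simp [hx, hxs, hs])
    simp only [coe_offDiag, Set.mem_offDiag, mem_coe, Prod.mk.injEq] at hly heq
    obtain ⟨rfl, h2⟩ := heq
    exact ⟨l, hly.1, by simpa using h2⟩
  have hvt : ∀ i ∈ I, v 0 + v (t i) = 0 := by
    intro i hi
    have hne : (I.erase i).Nonempty := by
      rw [← card_pos, card_erase_of_mem hi]; omega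
    have h1 := h (I.erase i) (erase_subset _ _) hne (by
      intro heq; rw [← heq] at hi; exact notMem_erase _ _ hi)
    have : ∀ s, s ∈ ({0, t i} : Finset G) ↔ ∀ x ∈ I.erase i, x + s ∈ I := by
      intro s
      simp only [mem_singleton, mem_erase, mem_insert]
      rw [iff_comm]
      constructor
      · intro hs
        by_contra! hcon
        obtain ⟨x, hx⟩ := hne
        obtain ⟨l, hl, rfl⟩ := hall s hcon.1 x (mem_of_mem_erase hx) (hs x (by simpa using hx))
        have hli : l ≠ i := by rintro rfl; exact hcon.2 rfl
        exact hti l hl (hs l ⟨hli, hl⟩)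
      · rintro (rfl | rfl) x hx
        · simpa using hx.2
        · exact ht i hi x hx.2 hx.1
    specialize h1 _ this
    rwa [sum_pair (ht0 i hi).symm] at h1
  obtain ⟨i, hi, k, hk, hik⟩ := one_lt_card.mp (show 1 < I.card by omega)
  have hne : ((I.erase i).erase k).Nonempty := by
    rw [← card_pos, card_erase_of_mem (mem_erase.2 ⟨hik.symm, hk⟩), card_erase_of_mem hi]; omega
  have h1 := h ((I.erase i).erase k) ((erase_subset _ _).trans (erase_subset _ _)) hne (by
    intro heq; rw [← heq] at hk; exact notMem_erase _ _ hk)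
  have : ∀ s, s ∈ ({0, t i, t k} : Finset G) ↔ ∀ x ∈ (I.erase i).erase k, x + s ∈ I := by
    intro s
    simp only [mem_singleton, mem_erase, mem_insert]
    rw [iff_comm]
    constructor
    · intro hs
      by_contra! hcon
      obtain ⟨x, hx⟩ := hne
      obtain ⟨l, hl, rfl⟩ := hall s hcon.1 x (mem_of_mem_erase (mem_of_mem_erase hx))
        (hs x (by simpa using hx))
      have hli : l ≠ i := by rintro rfl; exact hcon.2.1 rfl
      have hlk : l ≠ k := by rintro rfl; exact hcon.2.2 rfl
      exact hti l hl (hs l ⟨hlk, hli, hl⟩)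
    · rintro (rfl | rfl | rfl) x hx
      · simpa using hx.2.2
      · exact ht i hi x hx.2.2 hx.2.1
      · exact ht k hk x hx.2.2 hx.1
  specialize h1 _ this
  rw [sum_insert (by simp [(ht0 i hi).symm, (ht0 k hk).symm]),
    sum_pair (fun h => hik (htinj i hi k hk h)), ← add_assoc, hvt i hi, zero_add] at h1
  exact hv _ h1

/-- The natural number below `2 ^ m` whose binary digits are `1` exactly at the positions in `E`. -/
def binVal {m : ℕ} (E : Finset (ZMod m)) : ℕ := ∑ i ∈ E, 2 ^ i.val

theorem binVal_eq_sum_image {m : ℕ} [NeZero m] (E : Finset (ZMod m)) :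
    binVal E = ∑ i ∈ E.image ZMod.val, 2 ^ i := by
  rw [Finset.sum_image fun _ _ _ _ h => ZMod.val_injective m h, binVal]

theorem binVal_injective {m : ℕ} [NeZero m] :
    Function.Injective (binVal : Finset (ZMod m) → ℕ) := by
  intro E E' h
  rw [binVal_eq_sum_image, binVal_eq_sum_image] at h
  exact Finset.image_injective (ZMod.val_injective m) (Finset.geomSum_injective le_rfl h)

theorem binVal_lt {m : ℕ} [NeZero m] (E : Finset (ZMod m)) : binVal E < 2 ^ m := by
  rw [binVal_eq_sum_image]
  refine Nat.geomSum_lt le_rfl ?_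
  intro k hk
  obtain ⟨i, -, rfl⟩ := Finset.mem_image.1 hk
  exact ZMod.val_lt i

theorem exists_binVal_eq {m : ℕ} [NeZero m] {d : ℕ} (hd : d < 2 ^ m) :
    ∃ I : Finset (ZMod m), binVal I = d := by
  have hlt : ∀ i ∈ d.bitIndices.toFinset, i < m := by
    intro i hi
    have h1 : 2 ^ i ≤ d := Nat.two_pow_le_of_mem_bitIndices (List.mem_toFinset.1 hi)
    exact (Nat.pow_lt_pow_iff_right one_lt_two).1 (h1.trans_lt hd)
  refine ⟨d.bitIndices.toFinset.image (Nat.cast : ℕ → ZMod m), ?_⟩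
  rw [binVal_eq_sum_image, Finset.image_image]
  have : d.bitIndices.toFinset.image (ZMod.val ∘ (Nat.cast : ℕ → ZMod m)) =
      d.bitIndices.toFinset := by
    conv_rhs => rw [← Finset.image_id (s := d.bitIndices.toFinset)]
    exact Finset.image_congr fun i hi => by simpa using ZMod.val_cast_of_lt (hlt i hi)
  rw [this, Finset.sum_toFinset_bitIndices_two_pow]

theorem pow_binVal {m : ℕ} {K : Type*} [Field K] (x : K) (E : Finset (ZMod m)) :
    x ^ binVal E = ∏ i ∈ E, x ^ 2 ^ i.val := (Finset.prod_pow_eq_pow_sum _ _ _).symm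

theorem add_one_pow_binVal {m : ℕ} {K : Type*} [Field K] [CharP K 2] (x : K) (I : Finset (ZMod m)) :
    (x + 1) ^ binVal I = ∑ E ∈ I.powerset, x ^ binVal E := by
  rw [pow_binVal]
  simp_rw [add_pow_char_pow, one_pow, Finset.prod_add_one, pow_binVal]

section FiniteField

variable {m : ℕ} [NeZero m] {K : Type*} [Field K] [Fintype K]

/-- The monomial functions with distinct exponents below the field size are linearly independent. -/
theorem eq_zero_of_sum_mul_pow_binVal (hK : Fintype.card K = 2 ^ m) (c : Finset (ZMod m) → K)
    (h : ∀ x : K, ∑ E, c E * x ^ binVal E = 0) (E : Finset (ZMod m)) : c E = 0 := by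
  let P : Polynomial K := ∑ E, Polynomial.monomial (binVal E) (c E)
  have hP : P = 0 := by
    refine Polynomial.eq_zero_of_natDegree_lt_card_of_eval_eq_zero P (ι := K)
      Function.injective_id (fun x => ?_) ?_
    · simpa [P, Polynomial.eval_finsetSum] using h x
    · rw [hK, ← Nat.le_sub_one_iff_lt (by positivity)]
      refine Polynomial.natDegree_sum_le_of_forall_le _ _ fun E _ => ?_
      exact (Polynomial.natDegree_monomial_le _).trans (Nat.le_sub_one_of_lt (binVal_lt E))
  have := congrArg (fun Q => Polynomial.coeff Q (binVal E)) hP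
  simpa [P, Polynomial.finsetSum_coeff, Polynomial.coeff_monomial, binVal_injective.eq_iff]
    using this

theorem pow_two_pow_val_add (hK : Fintype.card K = 2 ^ m) (x : K) (i j : ZMod m) :
    x ^ 2 ^ (i + j).val = (x ^ 2 ^ i.val) ^ 2 ^ j.val := by
  rw [← pow_mul, ← pow_add, ZMod.val_add]
  conv_rhs => rw [← Nat.mod_add_div (i.val + j.val) m, pow_add, pow_mul, pow_mul 2 m, ← hK,
    FiniteField.pow_card_pow]

theorem pow_binVal_image_add (hK : Fintype.card K = 2 ^ m) (x : K) (E : Finset (ZMod m))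
    (t : ZMod m) : x ^ binVal (E.image (· + t)) = (x ^ binVal E) ^ 2 ^ t.val := by
  rw [pow_binVal, pow_binVal, Finset.prod_image fun _ _ _ _ h => add_right_cancel h,
    ← Finset.prod_pow]
  exact Finset.prod_congr rfl fun i _ => pow_two_pow_val_add hK x i t

theorem sum_translates_eq_zero [CharP K 2] (hK : Fintype.card K = 2 ^ m) (b : K)
    (I : Finset (ZMod m))
    (h : ∀ x : K, ∑ j : ZMod m, (b * ((x + 1) ^ binVal I + x ^ binVal I)) ^ 2 ^ j.val = 1)
    (E : Finset (ZMod m)) (hEI : E ⊆ I) (hE : E.Nonempty) (hne : E ≠ I)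
    (S : Finset (ZMod m)) (hS : ∀ t, t ∈ S ↔ ∀ x ∈ E, x + t ∈ I) :
    ∑ t ∈ S, b ^ 2 ^ (-t).val = 0 := by
  let c : Finset (ZMod m) → K := fun G =>
    ∑ j : ZMod m, ∑ D ∈ I.ssubsets, if D.image (· + j) = G then b ^ 2 ^ j.val else 0
  have hder : ∀ x : K, (x + 1) ^ binVal I + x ^ binVal I = ∑ D ∈ I.ssubsets, x ^ binVal D := by
    intro x
    rw [add_one_pow_binVal, ← Finset.add_sum_erase _ _ (Finset.mem_powerset_self I),
      add_right_comm, CharTwo.add_self_eq_zero, zero_add, Finset.ssubsets]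
  have hc : ∀ x : K, ∑ G, (c G - if G = ∅ then 1 else 0) * x ^ binVal G = 0 := by
    intro x
    simp_rw [sub_mul, Finset.sum_sub_distrib]
    rw [sub_eq_zero]
    have h1 : ∑ G, (if G = (∅ : Finset (ZMod m)) then (1 : K) else 0) * x ^ binVal G = 1 := by
      simp [binVal]
    rw [h1, ← h x]
    simp_rw [c, Finset.sum_mul]
    rw [Finset.sum_comm]
    refine Finset.sum_congr rfl fun j _ => ?_
    rw [Finset.sum_comm, hder, Finset.mul_sum, sum_pow_char_pow]
    refine Finset.sum_congr rfl fun D _ => ?_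
    rw [mul_pow, ← pow_binVal_image_add hK]
    simp only [ite_mul, zero_mul, Finset.sum_ite_eq, Finset.mem_univ, if_true]
  have h0 := eq_zero_of_sum_mul_pow_binVal hK _ hc E
  rw [if_neg hE.ne_empty, sub_zero] at h0
  rw [← h0, ← Finset.univ_inter S, ← Finset.sum_ite_mem, ← Equiv.sum_comp (Equiv.neg (ZMod m))]
  refine Finset.sum_congr rfl fun j _ => ?_
  simp only [Equiv.neg_apply, neg_neg]
  have him : ∀ D : Finset (ZMod m), D.image (· + j) = E ↔ D = E.image (· + -j) := by
    intro D
    constructor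
    · rintro rfl
      simp_rw [Finset.image_image, Function.comp_def, add_neg_cancel_right, Finset.image_id']
    · rintro rfl
      simp_rw [Finset.image_image, Function.comp_def, neg_add_cancel_right, Finset.image_id']
  simp_rw [him]
  rw [Finset.sum_ite_eq']
  refine if_congr ?_ rfl rfl
  rw [Finset.mem_ssubsets, Finset.ssubset_iff_subset_ne, Finset.image_subset_iff, hS]
  refine ⟨fun h => ⟨h, fun heq => ?_⟩, fun h => h.1⟩
  refine hne (Finset.eq_of_subset_of_card_le hEI ?_)
  rw [← heq, Finset.card_image_of_injective _ (add_left_injective _)]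

/-- If `d` is coprime to the order of the multiplicative group, then the set of binary digits of
`d` is not invariant under any nonzero cyclic shift. -/
theorem eq_zero_of_add_mem (hK : Fintype.card K = 2 ^ m) (I : Finset (ZMod m))
    (hI : Function.Injective fun x : K => x ^ binVal I) (t : ZMod m)
    (ht : ∀ x ∈ I, x + t ∈ I) : t = 0 := by
  have him : I.image (· + t) = I := Finset.eq_of_subset_of_card_le
    (Finset.image_subset_iff.2 ht) (Finset.card_image_of_injective _ (add_left_injective t)).ge
  have hfix : ∀ x : K, x ^ 2 ^ t.val = x := by
    intro x
    apply hI
    have := pow_binVal_image_add hK x I t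
    rw [him] at this
    dsimp only
    rw [← pow_mul, mul_comm, pow_mul]
    exact this.symm
  by_contra h0
  have := eq_zero_of_sum_mul_pow_binVal hK
    (fun E => (if E = {t} then 1 else 0) - if E = {0} then 1 else 0)
    (fun x => by
      simp only [sub_mul, ite_mul, one_mul, zero_mul, Finset.sum_sub_distrib, Finset.sum_ite_eq',
        Finset.mem_univ, if_true, binVal, Finset.sum_singleton, hfix x, ZMod.val_zero, pow_zero,
        pow_one, sub_self]) {t}
  simp [h0] at this

/-- A power function whose derivative in direction `1` has constant trace `1` after multiplication
by a nonzero `b` is linear or quadratic. -/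
theorem card_le_two_of_trace_derivative_eq_one [CharP K 2] (hK : Fintype.card K = 2 ^ m)
    {b : K} (hb : b ≠ 0)
    (I : Finset (ZMod m)) (hI : Function.Injective fun x : K => x ^ binVal I)
    (h : ∀ x : K, ∑ j : ZMod m, (b * ((x + 1) ^ binVal I + x ^ binVal I)) ^ 2 ^ j.val = 1) :
    I.card ≤ 2 :=
by
  refine card_le_two_of_sum_translates_eq_zero I (fun t => b ^ 2 ^ (-t).val) ?_ ?_ ?_
  · exact fun t => pow_ne_zero _ hb
  · exact eq_zero_of_add_mem hK I hI
  · intro E h1 h2 h3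
    exact sum_translates_eq_zero hK b I h E h1 h2 h3

end FiniteField

theorem chi_zero : chi 0 = 1 := by simp [chi]

theorem chi_one : chi 1 = -1 := by simp [chi, ZMod.val_one]

theorem zmod_two_eq_zero_or_one (a : ZMod 2) : a = 0 ∨ a = 1 := by
  fin_cases a
  · exact Or.inl rfl
  · exact Or.inr rfl

theorem one_add_one_zmod_two : (1 : ZMod 2) + 1 = 0 := CharTwo.add_self_eq_zero 1

theorem chi_add (a b : ZMod 2) : chi (a + b) = chi a * chi b := by
  rcases zmod_two_eq_zero_or_one a with rfl | rfl <;>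
  rcases zmod_two_eq_zero_or_one b with rfl | rfl <;>
  simp [chi_zero, chi_one, one_add_one_zmod_two]

theorem sum_chi_eq_zero {A : Type*} [AddGroup A] [Fintype A] (s : A →+ ZMod 2) (hs : s ≠ 0) :
    ∑ x, chi (s x) = 0 := by
  obtain ⟨y, hy⟩ := DFunLike.ne_iff.1 hs
  have hy1 : s y = 1 := (zmod_two_eq_zero_or_one _).resolve_left hy
  have h : ∑ x, chi (s x) = -∑ x, chi (s x) := by
    conv_lhs => rw [← Equiv.sum_comp (Equiv.addRight y)]
    simp [chi_add, hy1, chi_one]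
  omega

section GaloisField

variable {m : ℕ}

/-- The trace map as an additive homomorphism. -/
noncomputable def trHom (m : ℕ) : GaloisField 2 m →+ ZMod 2 :=
  (Algebra.trace (ZMod 2) (GaloisField 2 m)).toAddMonoidHom

theorem tr_add (x y : GaloisField 2 m) : tr m (x + y) = tr m x + tr m y := map_add (trHom m) x y

theorem tr_zero : tr m 0 = 0 := map_zero (trHom m)

theorem eq_zero_of_tr_mul_eq_zero {a : GaloisField 2 m} (h : ∀ x, tr m (a * x) = 0) : a = 0 :=
  (traceForm_nondegenerate (ZMod 2) (GaloisField 2 m)).1 a h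

theorem exists_eq_tr_mul (s : GaloisField 2 m →+ ZMod 2) : ∃ c, ∀ x, s x = tr m (c * x) := by
  obtain ⟨c, hc⟩ := ((Algebra.traceForm (ZMod 2) (GaloisField 2 m)).toDual
    (traceForm_nondegenerate (ZMod 2) (GaloisField 2 m))).surjective (s.toZModLinearMap 2)
  exact ⟨c, fun x => (LinearMap.congr_fun hc x).symm⟩

theorem card_galoisField (hm : m ≠ 0) : Fintype.card (GaloisField 2 m) = 2 ^ m := by
  rw [Fintype.card_eq_nat_card, GaloisField.card 2 m hm]

theorem sum_chi_tr_mul (hm : m ≠ 0) (u : GaloisField 2 m) :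
    ∑ γ, chi (tr m (u * γ)) = if u = 0 then 2 ^ m else 0 := by
  split_ifs with hu
  · simp [hu, tr_zero, chi_zero, card_galoisField hm]
  · refine sum_chi_eq_zero ((trHom m).comp (AddMonoidHom.mulLeft u)) fun h => hu ?_
    exact eq_zero_of_tr_mul_eq_zero fun x => DFunLike.congr_fun h x

theorem algebraMap_tr [NeZero m] (x : GaloisField 2 m) :
    algebraMap (ZMod 2) (GaloisField 2 m) (tr m x) = ∑ j : ZMod m, x ^ 2 ^ j.val := by
  rw [tr, FiniteField.algebraMap_trace_eq_sum_pow, GaloisField.finrank 2 (NeZero.ne m),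
    Nat.card_zmod]
  obtain ⟨n, rfl⟩ := Nat.exists_eq_succ_of_ne_zero (NeZero.ne m)
  exact (Fin.sum_univ_eq_sum_range (fun i => x ^ 2 ^ i) (n + 1)).symm

theorem tr_pow_two_pow [NeZero m] (x : GaloisField 2 m) (k : ℕ) : tr m (x ^ 2 ^ k) = tr m x := by
  apply (algebraMap (ZMod 2) (GaloisField 2 m)).injective
  have h : ∀ j : ZMod m, (x ^ 2 ^ k) ^ 2 ^ j.val = (x ^ 2 ^ j.val) ^ 2 ^ k := fun j => by
    rw [← pow_mul, ← pow_mul, mul_comm]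
  rw [algebraMap_tr]
  simp_rw [h]
  rw [← sum_pow_char_pow, ← algebraMap_tr, ← map_pow, ZMod.pow_card_pow]

theorem autocorrelation_eq (hm : m ≠ 0) (f : GaloisField 2 m → ZMod 2) (a : GaloisField 2 m) :
    ∑ γ, (∑ x, chi (f x + tr m (γ * x))) ^ 2 * chi (tr m (a * γ)) =
      2 ^ m * ∑ x, chi (f x + f (x + a)) := by
  have h1 : ∀ γ, (∑ x, chi (f x + tr m (γ * x))) ^ 2 * chi (tr m (a * γ)) =
      ∑ x, ∑ y, chi (f x + f y) * chi (tr m ((x + y + a) * γ)) := by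
    intro γ
    rw [sq, Finset.sum_mul_sum, Finset.sum_mul]
    refine Finset.sum_congr rfl fun x _ => ?_
    rw [Finset.sum_mul]
    refine Finset.sum_congr rfl fun y _ => ?_
    simp only [add_mul, tr_add, chi_add, mul_comm γ]
    ring
  simp_rw [h1]
  rw [Finset.sum_comm, Finset.mul_sum]
  refine Finset.sum_congr rfl fun x _ => ?_
  rw [Finset.sum_comm]
  simp_rw [← Finset.mul_sum, sum_chi_tr_mul hm]
  have h2 : ∀ y, x + y + a = 0 ↔ y = x + a := fun y => by
    rw [add_right_comm, CharTwo.add_eq_zero, eq_comm]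
  simp_rw [h2]
  simp [mul_comm]

/-- If the squared Walsh spectrum of a Boolean function vanishes exactly on the kernel of a linear
functional and is constant outside of it, then the function has exactly one nonzero linear
structure, and its derivative in that direction is identically `1`. -/
theorem exists_unique_linear_structure (hm : m ≠ 0) (f : GaloisField 2 m → ZMod 2)
    (s : GaloisField 2 m →+ ZMod 2)
    (hW : ∀ γ, (∑ x, chi (f x + tr m (γ * x))) ^ 2 = 2 ^ m * (1 - chi (s γ))) :
    ∃ c, c ≠ 0 ∧ (∀ x, f x + f (x + c) = 1) ∧
      ∀ a e, a ≠ 0 → (∀ x, f x + f (x + a) = e) → a = c := by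
  obtain ⟨c, hc⟩ := exists_eq_tr_mul s
  have hA : ∀ a, ∑ x, chi (f x + f (x + a)) =
      (if a = 0 then 2 ^ m else 0) - if a = c then 2 ^ m else 0 := by
    intro a
    have h1 := autocorrelation_eq hm f a
    have h2 : ∀ γ, (∑ x, chi (f x + tr m (γ * x))) ^ 2 * chi (tr m (a * γ)) =
        2 ^ m * (chi (tr m (a * γ)) - chi (tr m ((a + c) * γ))) := by
      intro γ
      rw [hW, hc, add_mul, tr_add, chi_add]
      ring
    simp_rw [h2] at h1
    rw [← Finset.mul_sum, Finset.sum_sub_distrib, sum_chi_tr_mul hm, sum_chi_tr_mul hm,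
      CharTwo.add_eq_zero] at h1
    exact (mul_left_cancel₀ (by positivity) h1).symm
  have hc0 : c ≠ 0 := by
    rintro rfl
    have := hA 0
    simp [CharTwo.add_self_eq_zero, chi_zero] at this
  refine ⟨c, hc0, fun x => ?_, fun a e ha hae => ?_⟩
  · refine (zmod_two_eq_zero_or_one _).resolve_left fun hx => ?_
    have h1 := hA c
    rw [if_neg hc0, if_pos rfl, zero_sub] at h1
    have h2 : ∑ _x : GaloisField 2 m, (-1 : ℤ) < ∑ x, chi (f x + f (x + c)) := by
      refine Finset.sum_lt_sum (fun y _ => ?_) ⟨x, Finset.mem_univ _, ?_⟩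
      · rcases zmod_two_eq_zero_or_one (f y + f (y + c)) with h | h <;>
          simp [h, chi_zero, chi_one]
      · simp [hx, chi_zero]
    rw [h1] at h2
    simp [card_galoisField hm] at h2
  · by_contra hac
    have h1 := hA a
    simp_rw [hae] at h1
    rw [if_neg ha, if_neg hac] at h1
    rcases zmod_two_eq_zero_or_one e with rfl | rfl <;> simp [chi_zero, chi_one] at h1

theorem pow_injective_of_gcd_eq_one (hm : m ≠ 0) {d : ℕ} (hd : d ≠ 0)
    (hgcd : Nat.gcd d (2 ^ m - 1) = 1) :
    Function.Injective fun x : GaloisField 2 m => x ^ d := by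
  intro x y hxy
  dsimp only at hxy
  by_cases hy : y = 0
  · subst hy
    rw [zero_pow hd] at hxy
    exact eq_zero_of_pow_eq_zero hxy
  have hx : x ≠ 0 := by
    rintro rfl
    rw [zero_pow hd] at hxy
    exact hy (eq_zero_of_pow_eq_zero hxy.symm)
  have h1 : (x / y) ^ d = 1 := by rw [div_pow, hxy, div_self (pow_ne_zero _ hy)]
  have h2 : (x / y) ^ (2 ^ m - 1) = 1 := by
    rw [← card_galoisField hm]
    exact FiniteField.pow_card_sub_one_eq_one _ (div_ne_zero hx hy)
  have h3 := pow_gcd_eq_one.2 ⟨h1, h2⟩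
  rwa [hgcd, pow_one, div_eq_one_iff_eq hy] at h3

theorem walsh_one_eq (d : ℕ) (γ : GaloisField 2 m) :
    walsh m d 1 γ = ∑ x, chi (tr m (x ^ d) + tr m (γ * x)) := by
  simp only [walsh, one_mul, tr_add, add_comm]

theorem walsh_one_zero (hm : m ≠ 0) {d : ℕ} (hd : d ≠ 0) (hgcd : Nat.gcd d (2 ^ m - 1) = 1) :
    walsh m d 1 0 = 0 := by
  have hb := Finite.injective_iff_bijective.1 (pow_injective_of_gcd_eq_one hm hd hgcd)
  simp only [walsh, zero_mul, zero_add, one_mul]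
  rw [hb.sum_comp fun x => chi (tr m x)]
  simpa using sum_chi_tr_mul hm (1 : GaloisField 2 m)

theorem eight_mul_card_inter (hm : m ≠ 0) (d : ℕ) {α β : GaloisField 2 m} (hα : α ≠ 0)
    (hβ : β ≠ 0) (hαβ : α ≠ β) :
    8 * ((Hij m α β 0 0 ∩ Dd m d).card : ℤ) =
      2 ^ m - (walsh m d 1 0 + walsh m d 1 α + walsh m d 1 β + walsh m d 1 (α + β)) := by
  have h1 : 8 * ((Hij m α β 0 0 ∩ Dd m d).card : ℤ) =
      ∑ x, (1 + chi (tr m (α * x))) * (1 + chi (tr m (β * x))) * (1 - chi (tr m (x ^ d))) := by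
    rw [Hij, Dd, ← Finset.filter_and, Finset.card_filter, Nat.cast_sum, Finset.mul_sum]
    refine Finset.sum_congr rfl fun x _ => ?_
    rcases zmod_two_eq_zero_or_one (tr m (α * x)) with h | h <;>
    rcases zmod_two_eq_zero_or_one (tr m (β * x)) with h' | h' <;>
    rcases zmod_two_eq_zero_or_one (tr m (x ^ d)) with h'' | h'' <;>
    simp [h, h', h'', chi_zero, chi_one]
  have h2 : ∀ x, (1 + chi (tr m (α * x))) * (1 + chi (tr m (β * x))) * (1 - chi (tr m (x ^ d))) =
      chi (tr m (0 * x)) + chi (tr m (α * x)) + chi (tr m (β * x)) + chi (tr m ((α + β) * x)) -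
      (chi (tr m (x ^ d) + tr m (0 * x)) + chi (tr m (x ^ d) + tr m (α * x)) +
        chi (tr m (x ^ d) + tr m (β * x)) + chi (tr m (x ^ d) + tr m ((α + β) * x))) := by
    intro x
    simp only [add_mul, tr_add, chi_add, zero_mul, tr_zero, chi_zero]
    ring
  rw [h1]
  simp_rw [h2, walsh_one_eq]
  simp only [Finset.sum_sub_distrib, Finset.sum_add_distrib, sum_chi_tr_mul hm]
  rw [if_pos trivial, if_neg hα, if_neg hβ, if_neg (fun h => hαβ (CharTwo.add_eq_zero.1 h))]
  ring

theorem exists_unique_linear_structure_pow (hmodd : Odd m) (hm1 : m ≠ 1) {d : ℕ} (hd : d ≠ 0)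
    (hgcd : Nat.gcd d (2 ^ m - 1) = 1) (hmax : MaxNonlinear m d)
    (hinter : ∀ α β : GaloisField 2 m, α ≠ 0 → β ≠ 0 → α ≠ β → ∀ i j : ZMod 2,
      ((Hij m α β i j ∩ Dd m d).card : ℤ) ∈
        ({2 ^ (m - 3), 2 ^ (m - 3) - 2 ^ ((m - 3) / 2),
          2 ^ (m - 3) + 2 ^ ((m - 3) / 2)} : Set ℤ)) :
    ∃ c : GaloisField 2 m, c ≠ 0 ∧ (∀ x, tr m (x ^ d) + tr m ((x + c) ^ d) = 1) ∧
      ∀ a e, a ≠ 0 → (∀ x, tr m (x ^ d) + tr m ((x + a) ^ d) = e) → a = c := by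
  have hm : m ≠ 0 := hmodd.pos.ne'
  obtain ⟨k, hk⟩ : ∃ k, m = 2 * k + 3 := by
    obtain ⟨l, hl⟩ := hmodd
    exact ⟨l - 1, by omega⟩
  have e1 : (m + 1) / 2 = k + 2 := by omega
  have e2 : m - 3 = k * 2 := by omega
  have e3 : k * 2 / 2 = k := by omega
  have e4 : (2 : ℤ) ^ m = 8 * (2 ^ k) ^ 2 := by rw [hk]; ring
  have hP : (0 : ℤ) < 2 ^ k := by positivity
  have hW : ∀ γ, walsh m d 1 γ = 0 ∨ walsh m d 1 γ = 4 * 2 ^ k ∨ walsh m d 1 γ = -(4 * 2 ^ k) := by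
    intro γ
    have := hmax 1 one_ne_zero γ
    rwa [e1, pow_add, mul_comm, Set.mem_insert_iff, Set.mem_insert_iff, Set.mem_singleton_iff]
      at this
  have hW0 := walsh_one_zero hm hd hgcd
  have hsum : ∀ α β : GaloisField 2 m, α ≠ 0 → β ≠ 0 → α ≠ β →
      walsh m d 1 α + walsh m d 1 β + walsh m d 1 (α + β) = 0 ∨
      walsh m d 1 α + walsh m d 1 β + walsh m d 1 (α + β) = 8 * 2 ^ k ∨
      walsh m d 1 α + walsh m d 1 β + walsh m d 1 (α + β) = -(8 * 2 ^ k) := by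
    intro α β hα hβ hαβ
    have h1 := eight_mul_card_inter hm d hα hβ hαβ
    have h2 := hinter α β hα hβ hαβ 0 0
    rw [e2, e3, pow_mul, Set.mem_insert_iff, Set.mem_insert_iff, Set.mem_singleton_iff] at h2
    rw [hW0, e4] at h1
    generalize ((2 : ℤ) ^ k) ^ 2 = Q at h1 h2
    omega
  let s : GaloisField 2 m → ZMod 2 := fun γ => if walsh m d 1 γ = 0 then 0 else 1
  have hs0 : s 0 = 0 := if_pos hW0
  have hs : ∀ α β, s (α + β) = s α + s β := by
    intro α β
    by_cases hα : α = 0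
    · rw [hα, zero_add, hs0, zero_add]
    by_cases hβ : β = 0
    · rw [hβ, add_zero, hs0, add_zero]
    by_cases hαβ : α = β
    · rw [hαβ, CharTwo.add_self_eq_zero, CharTwo.add_self_eq_zero, hs0]
    have h1 := hsum α β hα hβ hαβ
    have ha := hW α
    have hb := hW β
    have hab := hW (α + β)
    simp only [s]
    split_ifs
    all_goals first
      | simp [one_add_one_zmod_two]; done
      | (exfalso; omega)
  refine exists_unique_linear_structure hm (fun x => tr m (x ^ d)) (AddMonoidHom.mk' s hs) ?_
  intro γ
  rw [← walsh_one_eq, e4, AddMonoidHom.mk'_apply]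
  simp only [s]
  split_ifs with h
  · rw [h, chi_zero]; ring
  · rcases (hW γ).resolve_left h with h | h <;> rw [h, chi_one] <;> ring

theorem tr_add_tr_derivative_gold [NeZero m] (k : ℕ) {a : GaloisField 2 m} (ha : a ^ 2 ^ k = a)
    (x : GaloisField 2 m) :
    tr m (x ^ (2 ^ k + 1)) + tr m ((x + a) ^ (2 ^ k + 1)) = tr m (a ^ 2) := by
  have h1 : x ^ (2 ^ k + 1) + (x + a) ^ (2 ^ k + 1) = (x * a) ^ 2 ^ k + x * a + a ^ 2 := by
    rw [pow_succ, pow_succ, add_pow_char_pow, mul_pow, ha]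
    linear_combination x ^ 2 ^ k * x * CharTwo.two_eq_zero (R := GaloisField 2 m)
  rw [← tr_add, h1, tr_add, tr_add, tr_pow_two_pow, CharTwo.add_self_eq_zero, zero_add]

theorem exists_pow_two_pow_eq_self (hm : m ≠ 0) {k : ℕ} (hk : k ≠ 0) (hkm : Nat.gcd k m ≠ 1) :
    ∃ a : GaloisField 2 m, a ≠ 0 ∧ a ≠ 1 ∧ a ^ 2 ^ k = a := by
  set g := Nat.gcd k m with hg
  have hg0 : g ≠ 0 := (Nat.gcd_pos_of_pos_left _ (Nat.pos_of_ne_zero hk)).ne'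
  have h4 : 2 ^ 2 ≤ 2 ^ g := Nat.pow_le_pow_right two_pos (by omega)
  have hdm : 2 ^ g - 1 ∣ 2 ^ m - 1 := Nat.pow_sub_one_dvd_pow_sub_one 2 (Nat.gcd_dvd_right k m)
  have hdk : 2 ^ g - 1 ∣ 2 ^ k - 1 := Nat.pow_sub_one_dvd_pow_sub_one 2 (Nat.gcd_dvd_left k m)
  obtain ⟨u, hu⟩ := IsCyclic.exists_ofOrder_eq_natCard (α := (GaloisField 2 m)ˣ)
  rw [Nat.card_units, GaloisField.card 2 m hm] at hu
  obtain ⟨r, hr⟩ := hdm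
  have hr0 : r ≠ 0 := by
    rintro rfl
    have : 2 ^ 1 ≤ 2 ^ m := Nat.pow_le_pow_right two_pos (by omega)
    omega
  have hord : orderOf (u ^ r) = 2 ^ g - 1 := by
    rw [orderOf_pow_of_dvd hr0 (hu ▸ hr ▸ Dvd.intro_left _ rfl), hu, hr,
      Nat.mul_div_cancel _ (Nat.pos_of_ne_zero hr0)]
  refine ⟨(u ^ r : (GaloisField 2 m)ˣ), Units.ne_zero _, fun h => ?_, ?_⟩
  · rw [Units.val_eq_one] at h
    rw [h, orderOf_one] at hord
    omega
  · have h1 : (u ^ r) ^ (2 ^ k - 1) = 1 := orderOf_dvd_iff_pow_eq_one.1 (hord ▸ hdk)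
    have h2 : 2 ^ k = (2 ^ k - 1) + 1 := (Nat.sub_add_cancel Nat.one_le_two_pow).symm
    rw [h2, ← Units.val_pow_eq_pow_val, pow_succ, h1, one_mul]

end GaloisField

theorem exists_eq_two_pow_add_one {m : ℕ} [NeZero m] (I : Finset (ZMod m)) (hI : I.card ≤ 2)
    (hodd : Odd (binVal I)) (h2 : 2 ≤ binVal I) : ∃ k, k ≠ 0 ∧ binVal I = 2 ^ k + 1 := by
  have h0 : (0 : ZMod m) ∈ I := by
    by_contra h0
    refine Nat.not_even_iff_odd.2 hodd (Finset.even_sum _ fun i hi => ?_)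
    refine (Nat.even_pow.2 ⟨even_two, ?_⟩)
    rw [Ne, ZMod.val_eq_zero]
    rintro rfl
    exact h0 hi
  have hval : 2 ^ (0 : ZMod m).val = 1 := by rw [ZMod.val_zero, pow_zero]
  rw [binVal, ← Finset.add_sum_erase I _ h0, hval] at h2 ⊢
  have hcard : (I.erase 0).card = 1 := by
    have h1 : I.erase 0 ≠ ∅ := by
      intro h
      rw [h, Finset.sum_empty] at h2
      omega
    have := Finset.card_erase_of_mem h0
    have := Finset.card_pos.2 (Finset.nonempty_iff_ne_empty.2 h1)
    omega
  obtain ⟨k, hk⟩ := Finset.card_eq_one.1 hcard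
  have hk0 : k ≠ 0 := Finset.ne_of_mem_erase (hk ▸ Finset.mem_singleton_self k)
  refine ⟨k.val, by rwa [Ne, ZMod.val_eq_zero], ?_⟩
  rw [hk, Finset.sum_singleton, add_comm]

/-- Conversely, if a maximum nonlinear power map `x ↦ x^d` (`m` odd, `d` odd,
`2 ≤ d ≤ 2^m - 2`, `gcd(d, 2^m - 1) = 1`) has all intersections of `D_d` with codimension-2
subspaces of size `2^(m-3)` or `2^(m-3) ± 2^((m-3)/2)`, then `d` is a Gold exponent. -/
theorem stmt1 (m : ℕ) (hmodd : Odd m) (d : ℕ) (hdodd : Odd d)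
    (hd2 : 2 ≤ d) (hdle : d ≤ 2 ^ m - 2) (hgcd : Nat.gcd d (2 ^ m - 1) = 1)
    (hmax : MaxNonlinear m d)
    (hinter : ∀ α β : GaloisField 2 m, α ≠ 0 → β ≠ 0 → α ≠ β → ∀ i j : ZMod 2,
      ((Hij m α β i j ∩ Dd m d).card : ℤ) ∈
        ({2 ^ (m - 3), 2 ^ (m - 3) - 2 ^ ((m - 3) / 2),
          2 ^ (m - 3) + 2 ^ ((m - 3) / 2)} : Set ℤ)) :
    ∃ k : ℕ, 0 < k ∧ Nat.gcd k m = 1 ∧ d = 2 ^ k + 1 := by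
  have hm1 : m ≠ 1 := by
    rintro rfl
    norm_num at hdle
    omega
  have hm : m ≠ 0 := hmodd.pos.ne'
  have : NeZero m := ⟨hm⟩
  have hK := card_galoisField hm
  obtain ⟨c, hc0, hc, huniq⟩ :=
    exists_unique_linear_structure_pow hmodd hm1 (by omega) hgcd hmax hinter
  obtain ⟨I, rfl⟩ := exists_binVal_eq (m := m) (d := d) (by
    have := Nat.pos_of_ne_zero (pow_ne_zero m two_ne_zero)
    omega)
  have hI : I.card ≤ 2 := by
    refine card_le_two_of_trace_derivative_eq_one hK (pow_ne_zero (binVal I) hc0) I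
      (pow_injective_of_gcd_eq_one hm (by omega) hgcd) fun x => ?_
    rw [← algebraMap_tr, mul_add, ← mul_pow, ← mul_pow, mul_add, mul_one, add_comm, tr_add, hc,
      map_one]
  obtain ⟨k, hk0, hk⟩ := exists_eq_two_pow_add_one I hI hdodd hd2
  refine ⟨k, Nat.pos_of_ne_zero hk0, ?_, hk⟩
  by_contra hkm
  obtain ⟨a, ha0, ha1, ha⟩ := exists_pow_two_pow_eq_self hm hk0 hkm
  rw [hk] at huniq
  exact ha1 ((huniq a _ ha0 (tr_add_tr_derivative_gold k ha)).trans
    (huniq 1 _ one_ne_zero (tr_add_tr_derivative_gold k (one_pow _))).symm)
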